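/- arXiv:math/0407518 — 2 statements merged into one kernel-verified Lean document; each statement's English description precedes it below -/
import Mathlib

section
/- Let N ≥ 1 be an integer, let ζ ∈ ℂ be a primitive N-th root of unity, and let C, S be the N×N clock and shift matrices: C is the diagonal matrix with entries C_{jj} = ζ^j for j = 0, …, N−1, and S is the permutation matrix with S_{ij} = 1 when i ≡ j + 1 (mod N) and S_{ij} = 0 otherwise. If X and Y are invertible N×N complex matrices satisfying X·Y = ζ·(Y·X), then there exist an invertible N×N complex matrix P and nonzero complex scalars μ, ν such that P·X·P⁻¹ = μ·C and P·Y·P⁻¹ = ν·S. -/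
open scoped Matrix

section

open Matrix

/-- If `X Y = ζ Y X`, then powers of `Y` send a `μ`-eigenvector of `X` to an eigenvector with
eigenvalue multiplied by the corresponding power of `ζ`. -/
lemma Matrix.mulVec_pow_mulVec_of_mul_eq_smul {n R : Type*} [Fintype n] [DecidableEq n]
    [CommRing R] {X Y : Matrix n n R} {ζ μ : R} {v : n → R} (h : X * Y = ζ • (Y * X))
    (hv : X *ᵥ v = μ • v) (k : ℕ) :
    X *ᵥ (Y ^ k *ᵥ v) = (μ * ζ ^ k) • (Y ^ k *ᵥ v) := by
  induction k with
  | zero => simpa using hv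
  | succ k ih =>
    rw [pow_succ', ← mulVec_mulVec, mulVec_mulVec, h, smul_mulVec, ← mulVec_mulVec, ih,
      mulVec_smul, smul_smul]
    congr 1
    ring

/-- A matrix whose columns are eigenvectors of `X` for pairwise distinct eigenvalues is
invertible. -/
lemma Matrix.isUnit_of_col_eigenvector {n K : Type*} [Fintype n] [DecidableEq n] [Field K]
    {X : Matrix n n K} {d : n → K} {w : n → n → K} (hd : Function.Injective d)
    (hw : ∀ j, X *ᵥ w j = d j • w j) (hw₀ : ∀ j, w j ≠ 0) :
    IsUnit (Matrix.of fun i j => w j i) := by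
  rw [← linearIndependent_cols_iff_isUnit]
  refine Module.End.eigenvectors_linearIndependent' (Matrix.toLin' X) d hd w fun j => ?_
  rw [Module.End.hasEigenvector_iff, Module.End.mem_eigenspace_iff]
  exact ⟨by simpa using hw j, hw₀ j⟩

/-- If the `w j` are eigenvectors of `X` with pairwise distinct eigenvalues, the eigenspace
of each of them is a line. -/
lemma Matrix.exists_eq_smul_of_col_eigenvector {n K : Type*} [Fintype n] [DecidableEq n]
    [Field K] {X : Matrix n n K} {d : n → K} {w : n → n → K} (hd : Function.Injective d)
    (hw : ∀ j, X *ᵥ w j = d j • w j) (hw₀ : ∀ j, w j ≠ 0) {j₀ : n} {u : n → K}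
    (hu : X *ᵥ u = d j₀ • u) : ∃ c : K, u = c • w j₀ := by
  have hQ := isUnit_of_col_eigenvector hd hw hw₀
  obtain ⟨a, rfl⟩ := (mulVec_surjective_iff_isUnit.mpr hQ) u
  have hXQ : X * (Matrix.of fun i j => w j i) = (Matrix.of fun i j => w j i) * diagonal d := by
    ext i j
    have := congrFun (hw j) i
    rw [mul_diagonal]
    simpa [mul_apply, mulVec, dotProduct, mul_comm (d j)] using this
  rw [mulVec_mulVec, hXQ, ← mulVec_mulVec, ← mulVec_smul] at hu
  have ha := mulVec_injective_iff_isUnit.mpr hQ hu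
  refine ⟨a j₀, ?_⟩
  ext i
  rw [mulVec, dotProduct, Finset.sum_eq_single j₀]
  · simp [mul_comm]
  · intro j _ hj
    have := congrFun ha j
    rw [mulVec_diagonal, Pi.smul_apply, smul_eq_mul] at this
    rcases mul_eq_mul_right_iff.mp this with h | h
    · exact absurd (hd h) hj
    · simp [h]
  · simp

end


/-- Let N ≥ 1, ζ ∈ ℂ a primitive N-th root of unity, C the clock matrix
(diagonal with entries ζ^j) and S the shift matrix (S_{ij} = 1 when i ≡ j + 1 (mod N), and
0 otherwise). If X and Y are invertible N×N complex matrices with X·Y = ζ·(Y·X), then X and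
Y are simultaneously conjugate to nonzero scalar multiples of C and S respectively. -/
theorem clock_shift_uniqueness (N : ℕ) (hN : 1 ≤ N) (ζ : ℂ) (hζ : IsPrimitiveRoot ζ N)
    (C S : Matrix (Fin N) (Fin N) ℂ)
    (hC : C = Matrix.diagonal fun j : Fin N => ζ ^ (j : ℕ))
    (hS : S = Matrix.of fun i j : Fin N =>
      if (i : ℕ) % N = ((j : ℕ) + 1) % N then (1 : ℂ) else 0)
    (X Y : Matrix (Fin N) (Fin N) ℂ) (hX : IsUnit X) (hY : IsUnit Y)
    (hcomm : X * Y = ζ • (Y * X)) :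
    ∃ (P : Matrix (Fin N) (Fin N) ℂ) (μ ν : ℂ), IsUnit P ∧ μ ≠ 0 ∧ ν ≠ 0 ∧
      P * X * P⁻¹ = μ • C ∧ P * Y * P⁻¹ = ν • S := by
  have hN0 : N ≠ 0 := by omega
  have : NeZero N := ⟨hN0⟩
  obtain ⟨μ, hμ⟩ := Module.End.exists_eigenvalue (Matrix.toLin' X)
  obtain ⟨v, hv⟩ := hμ.exists_hasEigenvector
  have hXv : X *ᵥ v = μ • v := by simpa using hv.apply_eq_smul
  have hv0 : v ≠ 0 := hv.2
  have hμ0 : μ ≠ 0 := by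
    rintro rfl
    refine hv0 (Matrix.mulVec_injective_iff_isUnit.mpr hX ?_)
    simpa using hXv
  have hpow := Matrix.mulVec_pow_mulVec_of_mul_eq_smul hcomm hXv
  have hpow0 (k : ℕ) : Y ^ k *ᵥ v ≠ 0 := fun h =>
    hv0 (Matrix.mulVec_injective_iff_isUnit.mpr (hY.pow k) (by simpa using h))
  have hd : Function.Injective fun j : Fin N => μ * ζ ^ (j : ℕ) := fun i j hij =>
    Fin.ext (hζ.pow_inj i.2 j.2 (mul_left_cancel₀ hμ0 hij))
  obtain ⟨c, hc⟩ : ∃ c : ℂ, Y ^ N *ᵥ v = c • v := by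
    simpa using Matrix.exists_eq_smul_of_col_eigenvector (j₀ := (0 : Fin N))
      (u := Y ^ N *ᵥ v) hd (fun j => hpow j) (fun j => hpow0 j) (by
        simpa [hζ.pow_eq_one] using hpow N)
  have hc0 : c ≠ 0 := by
    rintro rfl
    exact hpow0 N (by simpa using hc)
  obtain ⟨ν, hν⟩ := IsAlgClosed.exists_pow_nat_eq c (by omega : 0 < N)
  have hν0 : ν ≠ 0 := by
    rintro rfl
    exact hc0 (by rw [← hν, zero_pow hN0])
  let w : ℕ → Fin N → ℂ := fun k => (ν ^ k)⁻¹ • (Y ^ k *ᵥ v)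
  have hXw (k : ℕ) : X *ᵥ w k = (μ * ζ ^ k) • w k := by
    simp only [w, Matrix.mulVec_smul, hpow]
    exact smul_comm _ _ _
  have hw0 (k : ℕ) : w k ≠ 0 := smul_ne_zero (inv_ne_zero (pow_ne_zero k hν0)) (hpow0 k)
  have hYw (k : ℕ) : Y *ᵥ w k = ν • w (k + 1) := by
    simp only [w, Matrix.mulVec_smul, Matrix.mulVec_mulVec, ← pow_succ', smul_smul]
    congr 1
    field_simp
    ring
  have hwN : w N = w 0 := by
    simp only [w, hc, hν, smul_smul, inv_mul_cancel₀ hc0]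
    simp
  have hmod (j : Fin N) : w ((j + 1) % N) = w (j + 1) := by
    rcases (Nat.succ_le_of_lt j.2).lt_or_eq with h | h
    · rw [Nat.mod_eq_of_lt h]
    · have h' : (j : ℕ) + 1 = N := h
      rw [h', Nat.mod_self, hwN]
  let Q : Matrix (Fin N) (Fin N) ℂ := Matrix.of fun i j => w j i
  have hQ : IsUnit Q := Matrix.isUnit_of_col_eigenvector hd (fun j => hXw j) (fun j => hw0 j)
  have hQdet : IsUnit Q.det := (Matrix.isUnit_iff_isUnit_det Q).mp hQ
  have hXQ : X * Q = Q * (μ • C) := by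
    ext i j
    have := congrFun (hXw j) i
    rw [hC, Matrix.mul_smul, Matrix.smul_apply, Matrix.mul_diagonal]
    simpa [Q, Matrix.mul_apply, Matrix.mulVec, dotProduct, mul_assoc, mul_comm,
      mul_left_comm] using this
  have hYQ : Y * Q = Q * (ν • S) := by
    ext i j
    have hlhs : (Y * Q) i j = ν * w (j + 1) i := congrFun (hYw j) i
    rw [hlhs, Matrix.mul_smul, Matrix.smul_apply, smul_eq_mul, Matrix.mul_apply,
      Finset.sum_eq_single (⟨(j + 1) % N, Nat.mod_lt _ (by omega)⟩ : Fin N)]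
    · simp [Q, hS, hmod]
    · intro k _ hk
      have : ¬ (k : ℕ) % N = ((j : ℕ) + 1) % N := fun h =>
        hk (Fin.ext (by rwa [Nat.mod_eq_of_lt k.2] at h))
      simp [hS, this]
    · simp
  refine ⟨Q⁻¹, μ, ν, (Matrix.isUnit_nonsing_inv_iff).mpr hQ, hμ0, hν0, ?_, ?_⟩
  · rw [Matrix.nonsing_inv_nonsing_inv Q hQdet, mul_assoc, hXQ,
      Matrix.nonsing_inv_mul_cancel_left _ _ hQdet]
  · rw [Matrix.nonsing_inv_nonsing_inv Q hQdet, mul_assoc, hYQ,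
      Matrix.nonsing_inv_mul_cancel_left _ _ hQdet]
end

section
/- Let N ≥ 1 be an integer and let ζ ∈ ℂ be a primitive N-th root of unity. Let X and Y be invertible N×N complex matrices satisfying X·Y = ζ·(Y·X). Then the set of N×N complex matrices Z with det Z = 1 that commute with both X and Y is exactly the set {λ·I : λ ∈ ℂ, λ^N = 1}; in particular, this set has exactly N elements. -/
open Module in
/-- An eigenvector of `f` is moved through eigenvectors with eigenvalues `μ, ζ μ, ζ² μ, …` by the
powers of `g` when `f` and `g` commute up to the scalar `ζ`. -/
theorem Module.End.HasEigenvector.pow_of_comm_smul {K V : Type*} [Field K] [AddCommGroup V]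
    [Module K V] {f g : End K V} {ζ μ : K} (hg : Function.Injective g)
    (hfg : f * g = ζ • (g * f)) {v : V} (hv : f.HasEigenvector μ v) (k : ℕ) :
    f.HasEigenvector (ζ ^ k * μ) ((g ^ k) v) := by
  induction k with
  | zero => simpa using hv
  | succ k ih =>
    rw [End.hasEigenvector_iff, End.mem_eigenspace_iff] at ih ⊢
    rw [pow_succ' g, End.mul_apply]
    refine ⟨?_, fun h => ih.2 (hg (h.trans (map_zero g).symm))⟩
    have h := LinearMap.congr_fun hfg ((g ^ k) v)
    rw [End.mul_apply, LinearMap.smul_apply, End.mul_apply, ih.1, map_smul, smul_smul] at h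
    rw [h, pow_succ', mul_assoc]

open Module in
/-- If `f` and `g` are injective and commute up to a primitive root of unity whose order is the
dimension of the space, then only scalars commute with both. -/
theorem Module.End.exists_eq_smul_one_of_commute {K V : Type*} [Field K] [IsAlgClosed K]
    [AddCommGroup V] [Module K V] [FiniteDimensional K V] [Nontrivial V] {ζ : K}
    (hζ : IsPrimitiveRoot ζ (finrank K V)) {f g z : End K V}
    (hf : Function.Injective f) (hg : Function.Injective g) (hfg : f * g = ζ • (g * f))
    (hzf : Commute z f) (hzg : Commute z g) : ∃ c : K, z = c • 1 := by
  obtain ⟨c, hc⟩ := End.exists_eigenvalue z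
  have hmaps : ∀ x ∈ z.eigenspace c, f x ∈ z.eigenspace c :=
    End.mapsTo_genEigenspace_of_comm hzf c 1
  have : Nontrivial (z.eigenspace c) := Submodule.nontrivial_iff_ne_bot.mpr hc
  obtain ⟨μ, hμ⟩ := End.exists_eigenvalue (f.restrict hmaps)
  obtain ⟨w, hw⟩ := hμ.exists_hasEigenvector
  have hv : f.HasEigenvector μ (w : V) := by
    rw [End.hasEigenvector_iff, End.mem_eigenspace_iff] at hw ⊢
    exact ⟨congrArg Subtype.val hw.1, fun h => hw.2 (Subtype.ext h)⟩
  have hμ0 : μ ≠ 0 := by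
    rintro rfl
    refine hv.2 (hf ?_)
    rw [hv.apply_eq_smul, zero_smul, map_zero]
  have hinj : Function.Injective fun k : Fin (finrank K V) => ζ ^ (k : ℕ) * μ := fun i j hij =>
    Fin.ext (hζ.pow_inj i.2 j.2 (mul_right_cancel₀ hμ0 hij))
  have hli := End.eigenvectors_linearIndependent' f _ hinj _
    fun k => hv.pow_of_comm_smul hg hfg (k : ℕ)
  have hspan := hli.span_eq_top_of_card_eq_finrank' (Fintype.card_fin _)
  refine ⟨c, LinearMap.ext_on_range hspan fun k => ?_⟩
  have hmem := End.mapsTo_genEigenspace_of_comm (hzg.pow_right (k : ℕ)) c 1 w.2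
  simpa using End.mem_eigenspace_iff.mp hmem

/-- Matrix version of `Module.End.exists_eq_smul_one_of_commute`. -/
theorem Matrix.exists_eq_smul_one_of_commute {K : Type*} [Field K] [IsAlgClosed K]
    {n : Type*} [Fintype n] [DecidableEq n] [Nonempty n] {ζ : K}
    (hζ : IsPrimitiveRoot ζ (Fintype.card n)) {X Y Z : Matrix n n K}
    (hX : IsUnit X) (hY : IsUnit Y) (hXY : X * Y = ζ • (Y * X))
    (hZX : Commute Z X) (hZY : Commute Z Y) : ∃ c : K, Z = c • 1 := by
  have hζ' : IsPrimitiveRoot ζ (Module.finrank K (n → K)) := by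
    rwa [Module.finrank_fintype_fun_eq_card]
  obtain ⟨c, hc⟩ := Module.End.exists_eq_smul_one_of_commute hζ'
    (f := Matrix.toLinAlgEquiv' X) (g := Matrix.toLinAlgEquiv' Y) (z := Matrix.toLinAlgEquiv' Z)
    (Matrix.mulVec_injective_of_isUnit hX) (Matrix.mulVec_injective_of_isUnit hY)
    (by rw [← map_mul, hXY, map_smul, map_mul])
    (hZX.map Matrix.toLinAlgEquiv') (hZY.map Matrix.toLinAlgEquiv')
  exact ⟨c, Matrix.toLinAlgEquiv'.injective (by rw [hc, map_smul, map_one])⟩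

/-- The scalar matrices whose scalar is an `N`-th root of unity are `N` in number as soon as there
is a primitive `N`-th root of unity. -/
theorem IsPrimitiveRoot.ncard_smul_one_matrix {K : Type*} [Field K] {N : ℕ} (hN : 0 < N) {ζ : K}
    (hζ : IsPrimitiveRoot ζ N) {n : Type*} [Fintype n] [DecidableEq n] [Nonempty n] :
    {Z : Matrix n n K | ∃ c : K, c ^ N = 1 ∧ Z = c • (1 : Matrix n n K)}.ncard = N := by
  have h : {Z : Matrix n n K | ∃ c : K, c ^ N = 1 ∧ Z = c • (1 : Matrix n n K)}
      = (fun c : K => c • (1 : Matrix n n K)) '' (Polynomial.nthRootsFinset N (1 : K)) := by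
    ext Z
    simp [Polynomial.mem_nthRootsFinset hN, eq_comm]
  rw [h, Set.ncard_image_of_injective _ (smul_left_injective K one_ne_zero),
    Set.ncard_coe_finset, hζ.card_nthRootsFinset]


/-- Let N ≥ 1 and ζ ∈ ℂ a primitive N-th root of unity. Let X and Y be
invertible N×N complex matrices with X·Y = ζ·(Y·X). Then the set of determinant-1 matrices
commuting with both X and Y is exactly the set of λ·I with λ^N = 1, and it has exactly N
elements. -/
theorem det_one_commutant_eq_roots_of_unity (N : ℕ) (hN : 1 ≤ N)
    (ζ : ℂ) (hζ : IsPrimitiveRoot ζ N)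
    (X Y : Matrix (Fin N) (Fin N) ℂ) (hX : IsUnit X) (hY : IsUnit Y)
    (hcomm : X * Y = ζ • (Y * X)) :
    {Z : Matrix (Fin N) (Fin N) ℂ | Z.det = 1 ∧ Z * X = X * Z ∧ Z * Y = Y * Z}
        = {Z : Matrix (Fin N) (Fin N) ℂ |
            ∃ c : ℂ, c ^ N = 1 ∧ Z = c • (1 : Matrix (Fin N) (Fin N) ℂ)} ∧
      {Z : Matrix (Fin N) (Fin N) ℂ |
        Z.det = 1 ∧ Z * X = X * Z ∧ Z * Y = Y * Z}.ncard = N := by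
  have : Nonempty (Fin N) := ⟨⟨0, hN⟩⟩
  have heq : {Z : Matrix (Fin N) (Fin N) ℂ | Z.det = 1 ∧ Z * X = X * Z ∧ Z * Y = Y * Z}
      = {Z : Matrix (Fin N) (Fin N) ℂ |
          ∃ c : ℂ, c ^ N = 1 ∧ Z = c • (1 : Matrix (Fin N) (Fin N) ℂ)} := by
    ext Z
    constructor
    · rintro ⟨hdet, hZX, hZY⟩
      obtain ⟨c, rfl⟩ := Matrix.exists_eq_smul_one_of_commute (by rwa [Fintype.card_fin])
        hX hY hcomm hZX hZY
      exact ⟨c, by simpa using hdet, rfl⟩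
    · rintro ⟨c, hc, rfl⟩
      simpa using hc
  exact ⟨heq, heq ▸ hζ.ncard_smul_one_matrix hN⟩
end
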